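/- (Davenport) Let Ω = {θ₁, θ₂, ..., θ_k} ⊂ [0, π/2] be a finite set. Then there exists α ∈ [0, π/2] such that each of the numbers tan(α − θ₁), ..., tan(α − θ_k) is badly approximable, i.e. for each j there exists c_j > 0 such that |tan(α − θ_j) − p/q| ≥ c_j/q² for all integers p and all positive integers q. -/

import Mathlib

/-- A closed interval contains, for finitely many sets of small diameter, a subinterval which is
shorter by a factor `3 ^ #s` and avoids all of these sets. -/
lemma exists_subinterval_avoiding {ι : Type*} (s : Finset ι) (B : ι → Set ℝ) (a L : ℝ) (hL : 0 < L)
    (hB : ∀ j ∈ s, ∀ x ∈ B j, ∀ y ∈ B j, x ∈ Set.Icc a (a + L) → y ∈ Set.Icc a (a + L) →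
      |x - y| < L / 3 ^ s.card) :
    ∃ a', a ≤ a' ∧ a' + L / 3 ^ s.card ≤ a + L ∧
      ∀ j ∈ s, ∀ x ∈ Set.Icc a' (a' + L / 3 ^ s.card), x ∉ B j := by
  classical
  induction s using Finset.induction_on generalizing a L with
  | empty => exact ⟨a, le_rfl, by simp, by simp⟩
  | insert j s hj ih =>
    rw [Finset.card_insert_of_notMem hj] at hB ⊢
    have hpow : L / 3 ^ (s.card + 1) = L / 3 / 3 ^ s.card := by
      rw [pow_succ, div_div, mul_comm]
    rw [hpow] at hB ⊢
    have hle : L / 3 / 3 ^ s.card ≤ L / 3 :=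
      div_le_self (by positivity) (one_le_pow₀ (by norm_num))
    obtain ⟨b, hab, hbL, hb⟩ : ∃ b, a ≤ b ∧ b + L / 3 ≤ a + L ∧
        ∀ x ∈ Set.Icc b (b + L / 3), x ∉ B j := by
      by_contra! h
      obtain ⟨x, hx, hxB⟩ := h a le_rfl (by linarith)
      obtain ⟨y, hy, hyB⟩ := h (a + 2 * L / 3) (by linarith) (by linarith)
      have hxy := hB j (Finset.mem_insert_self j s) x hxB y hyB
        ⟨hx.1, by linarith [hx.2]⟩ ⟨by linarith [hy.1], by linarith [hy.2]⟩
      rw [abs_sub_comm] at hxy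
      linarith [le_abs_self (y - x), hx.2, hy.1]
    obtain ⟨a', hba', ha'L, ha'⟩ := ih b (L / 3) (by positivity)
      fun i hi x hx y hy hxI hyI ↦ hB i (Finset.mem_insert_of_mem hi) x hx y hy
        ⟨hab.trans hxI.1, hxI.2.trans hbL⟩ ⟨hab.trans hyI.1, hyI.2.trans hbL⟩
    refine ⟨a', hab.trans hba', ha'L.trans hbL, fun i hi x hx ↦ ?_⟩
    rcases Finset.mem_insert.1 hi with rfl | hi
    · exact hb x ⟨hba'.trans hx.1, hx.2.trans ha'L⟩
    · exact ha' i hi x hx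

/-- Two fractions with denominators less than `√N` at distance at most `1 / N` are equal. -/
lemma div_eq_div_of_abs_sub_le {p p' : ℤ} {q q' : ℕ} {N : ℝ} (hq : 0 < q) (hq' : 0 < q')
    (hqN : (q : ℝ) ^ 2 < N) (hqN' : (q' : ℝ) ^ 2 < N)
    (h : |(p : ℝ) / q - p' / q'| ≤ 1 / N) : (p : ℝ) / q = p' / q' := by
  have hq0 : (0 : ℝ) < q := by exact_mod_cast hq
  have hq0' : (0 : ℝ) < q' := by exact_mod_cast hq'
  have hN : 0 < N := (sq_nonneg _).trans_lt hqN
  by_contra hne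
  have hnum : (p * q' - q * p' : ℤ) ≠ 0 := by
    intro h0
    apply hne
    rw [div_eq_div_iff hq0.ne' hq0'.ne']
    have : ((p * q' - q * p' : ℤ) : ℝ) = 0 := by rw [h0]; simp
    push_cast at this
    linarith
  have hone : (1 : ℝ) ≤ |(p : ℝ) * q' - q * p'| := by
    exact_mod_cast Int.one_le_abs hnum
  rw [div_sub_div _ _ hq0.ne' hq0'.ne', abs_div, abs_of_pos (mul_pos hq0 hq0'),
    div_le_div_iff₀ (mul_pos hq0 hq0') hN] at h
  nlinarith [sq_nonneg ((q : ℝ) - q')]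

/-- The points of an interval of length `ℓ / R ^ n` at which `f` is within `c / q ^ 2` of a fraction
with denominator `q`, `R ^ n ≤ q ^ 2 < R ^ (n + 1)`, are close to each other. -/
lemma abs_sub_lt_of_near_fraction {f : ℝ → ℝ} {x y M ℓ R c : ℝ} {n : ℕ} (hR : 1 ≤ R)
    (hc : 0 < c) (hM : 0 ≤ M) (hℓ : (M + 1) * ℓ ≤ 1 / R) (hcℓ : 2 * c = ℓ / R)
    (hlow : |x - y| ≤ |f x - f y|) (hup : |f x - f y| ≤ M * |x - y|) (hxy : |x - y| ≤ ℓ / R ^ n)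
    {p p' : ℤ} {q q' : ℕ} (hq : 0 < q) (hq' : 0 < q')
    (hqn : R ^ n ≤ (q : ℝ) ^ 2) (hqn' : R ^ n ≤ (q' : ℝ) ^ 2)
    (hqN : (q : ℝ) ^ 2 < R ^ (n + 1)) (hqN' : (q' : ℝ) ^ 2 < R ^ (n + 1))
    (hx : |f x - p / q| < c / (q : ℝ) ^ 2) (hy : |f y - p' / q'| < c / (q' : ℝ) ^ 2) :
    |x - y| < ℓ / R ^ n / R := by
  have hR0 : 0 < R := by linarith
  have hRn : 0 < R ^ n := by positivity
  have hx' : |f x - p / q| < c / R ^ n :=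
    hx.trans_le (div_le_div_of_nonneg_left hc.le hRn hqn)
  have hy' : |f y - p' / q'| < c / R ^ n :=
    hy.trans_le (div_le_div_of_nonneg_left hc.le hRn hqn')
  have hc2 : c / R ^ n + c / R ^ n = ℓ / R ^ n / R := by
    rw [← add_div, ← two_mul, hcℓ, div_right_comm]
  have hℓ0 : 0 < ℓ := by
    have : ℓ = 2 * c * R := by rw [hcℓ]; field_simp
    rw [this]; positivity
  have hsmall : ℓ / R ^ n / R ≤ ℓ / R ^ n := div_le_self (by positivity) hR
  have hfrac : (p : ℝ) / q = p' / q' := by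
    refine div_eq_div_of_abs_sub_le hq hq' hqN hqN' ?_
    have hMxy : |f x - f y| ≤ M * (ℓ / R ^ n) := hup.trans (by gcongr)
    have hbound : (M + 1) * ℓ / R ^ n ≤ 1 / R ^ (n + 1) := by
      calc (M + 1) * ℓ / R ^ n ≤ 1 / R / R ^ n := by gcongr
        _ = 1 / R ^ (n + 1) := by rw [div_div, pow_succ']
    have hsplit : (M + 1) * ℓ / R ^ n = M * (ℓ / R ^ n) + ℓ / R ^ n := by ring
    rw [abs_lt] at hx' hy'
    rw [abs_le] at hMxy ⊢
    constructor <;> linarith [hx'.1, hx'.2, hy'.1, hy'.2, hMxy.1, hMxy.2]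
  rw [hfrac] at hx'
  refine hlow.trans_lt ?_
  rw [← hc2]
  rw [abs_lt] at hx' hy' ⊢
  constructor <;> linarith [hx'.1, hx'.2, hy'.1, hy'.2]

/-- Finitely many maps which are bi-Lipschitz on an interval take badly approximable values
simultaneously at some point of it. -/
theorem exists_forall_badly_approximable {ι : Type*} [Fintype ι] [Nonempty ι] (f : ι → ℝ → ℝ)
    {a b M : ℝ} (hab : a < b) (hM : 0 ≤ M)
    (hlow : ∀ j, ∀ x ∈ Set.Icc a b, ∀ y ∈ Set.Icc a b, |x - y| ≤ |f j x - f j y|)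
    (hup : ∀ j, ∀ x ∈ Set.Icc a b, ∀ y ∈ Set.Icc a b, |f j x - f j y| ≤ M * |x - y|) :
    ∃ α ∈ Set.Icc a b, ∃ c : ℝ, 0 < c ∧ ∀ (j : ι) (p : ℤ) (q : ℕ), 0 < q →
      c / (q : ℝ) ^ 2 ≤ |f j α - p / q| := by
  obtain ⟨R, hRdef⟩ : ∃ R : ℝ, R = 3 ^ (Finset.univ : Finset ι).card := ⟨_, rfl⟩
  have hR1 : 1 < R := by
    rw [hRdef]
    exact one_lt_pow₀ (by norm_num) Finset.univ_nonempty.card_pos.ne'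
  have hR0 : 0 < R := by linarith
  obtain ⟨ℓ, hℓ0, hℓab, hℓM⟩ : ∃ ℓ : ℝ, 0 < ℓ ∧ ℓ ≤ b - a ∧ (M + 1) * ℓ ≤ 1 / R := by
    refine ⟨min (b - a) (1 / R / (M + 1)), lt_min (by linarith) (by positivity),
      min_le_left _ _, ?_⟩
    rw [mul_comm, ← le_div_iff₀ (by linarith)]
    exact min_le_right _ _
  obtain ⟨c, hc⟩ : ∃ c : ℝ, 2 * c = ℓ / R := ⟨ℓ / R / 2, by ring⟩
  have hc0 : 0 < c := by
    have : 0 < ℓ / R := by positivity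
    linarith
  let B (n : ℕ) (j : ι) : Set ℝ := {x | ∃ (p : ℤ) (q : ℕ), 0 < q ∧ R ^ n ≤ (q : ℝ) ^ 2 ∧
    (q : ℝ) ^ 2 < R ^ (n + 1) ∧ |f j x - p / q| < c / (q : ℝ) ^ 2}
  have step (n : ℕ) (u : {u : ℝ // a ≤ u ∧ u + ℓ / R ^ n ≤ b}) :
      ∃ v : {v : ℝ // a ≤ v ∧ v + ℓ / R ^ (n + 1) ≤ b}, u.1 ≤ v.1 ∧
        v.1 + ℓ / R ^ (n + 1) ≤ u.1 + ℓ / R ^ n ∧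
        ∀ j, ∀ x ∈ Set.Icc v.1 (v.1 + ℓ / R ^ (n + 1)), x ∉ B n j := by
    obtain ⟨u, hau, hub⟩ := u
    obtain ⟨v, huv, hvu, hv⟩ := exists_subinterval_avoiding Finset.univ (B n) u (ℓ / R ^ n)
      (by positivity) (by
        rintro j - x ⟨p, q, hq, hqn, hqN, hx⟩ y ⟨p', q', hq', hqn', hqN', hy⟩ hxI hyI
        have hxI' : x ∈ Set.Icc a b := ⟨hau.trans hxI.1, hxI.2.trans hub⟩
        have hyI' : y ∈ Set.Icc a b := ⟨hau.trans hyI.1, hyI.2.trans hub⟩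
        rw [← hRdef]
        refine abs_sub_lt_of_near_fraction hR1.le hc0 hM hℓM hc (hlow j x hxI' y hyI')
          (hup j x hxI' y hyI') ?_ hq hq' hqn hqn' hqN hqN' hx hy
        rw [abs_le]
        constructor <;> linarith [hxI.1, hxI.2, hyI.1, hyI.2])
    rw [← hRdef, div_div, ← pow_succ] at hvu hv
    exact ⟨⟨v, hau.trans huv, hvu.trans hub⟩, huv, hvu, fun j ↦ hv j (Finset.mem_univ j)⟩
  choose next hnext_le hnext_sub hnext_avoid using step
  let u (n : ℕ) : {u : ℝ // a ≤ u ∧ u + ℓ / R ^ n ≤ b} :=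
    Nat.rec ⟨a, le_rfl, by simp only [pow_zero, div_one]; linarith⟩ next n
  have hanti : Antitone fun n ↦ Set.Icc (u n).1 ((u n).1 + ℓ / R ^ n) :=
    antitone_nat_of_succ_le fun n ↦ Set.Icc_subset_Icc (hnext_le n (u n)) (hnext_sub n (u n))
  have hmem := ciSup_mem_iInter_Icc_of_antitone_Icc hanti
    fun n ↦ le_add_of_nonneg_right (by positivity)
  rw [Set.mem_iInter] at hmem
  refine ⟨_, ⟨(u 0).2.1.trans (hmem 0).1, (hmem 0).2.trans (u 0).2.2⟩, c, hc0,
    fun j p q hq ↦ ?_⟩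
  have hq1 : (1 : ℝ) ≤ (q : ℝ) ^ 2 := one_le_pow₀ (by exact_mod_cast hq)
  obtain ⟨n, hn, hn'⟩ := exists_nat_pow_near hq1 hR1
  by_contra! hlt
  exact hnext_avoid n (u n) j _ (hmem (n + 1)) ⟨p, q, hq, hn, hn', hlt⟩

/-- The mean value theorem for the tangent on a symmetric interval inside `(-π / 2, π / 2)`. -/
lemma exists_tan_sub_eq {r x y : ℝ} (hr : r < Real.pi / 2) (hx : |x| ≤ r) (hy : |y| ≤ r) :
    ∃ z, |z| ≤ r ∧ Real.tan x - Real.tan y = 1 / Real.cos z ^ 2 * (x - y) := by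
  wlog hyx : y < x generalizing x y
  · rcases (not_lt.1 hyx).eq_or_lt with rfl | hxy
    · exact ⟨x, hx, by simp⟩
    · obtain ⟨z, hz, h⟩ := this hy hx hxy
      exact ⟨z, hz, by linarith⟩
  rw [abs_le] at hx hy
  have hderiv (z : ℝ) (hz : z ∈ Set.Icc y x) : HasDerivAt Real.tan (1 / Real.cos z ^ 2) z :=
    Real.hasDerivAt_tan (Real.cos_pos_of_mem_Ioo
      ⟨by linarith [hz.1, hy.1], by linarith [hz.2, hx.2]⟩).ne'
  obtain ⟨z, hz, h⟩ := exists_hasDerivAt_eq_slope Real.tan (fun z ↦ 1 / Real.cos z ^ 2) hyx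
    (fun z hz ↦ (hderiv z hz).continuousAt.continuousWithinAt)
    (fun z hz ↦ hderiv z (Set.Ioo_subset_Icc_self hz))
  refine ⟨z, abs_le.2 ⟨by linarith [hz.1, hy.1], by linarith [hz.2, hx.2]⟩, ?_⟩
  rw [h, div_mul_cancel₀ _ (sub_pos.2 hyx).ne']

lemma abs_sub_le_abs_tan_sub {r x y : ℝ} (hr : r < Real.pi / 2) (hx : |x| ≤ r) (hy : |y| ≤ r) :
    |x - y| ≤ |Real.tan x - Real.tan y| := by
  obtain ⟨z, hz, h⟩ := exists_tan_sub_eq hr hx hy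
  have hcos : 0 < Real.cos z :=
    Real.cos_pos_of_mem_Ioo (abs_lt.1 (hz.trans_lt hr))
  rw [h, abs_mul, abs_of_pos (by positivity : 0 < 1 / Real.cos z ^ 2)]
  refine le_mul_of_one_le_left (abs_nonneg _) ?_
  rw [one_le_div (by positivity)]
  exact Real.cos_sq_le_one z

lemma abs_tan_sub_le {r x y : ℝ} (hr : r < Real.pi / 2) (hx : |x| ≤ r) (hy : |y| ≤ r) :
    |Real.tan x - Real.tan y| ≤ 1 / Real.cos r ^ 2 * |x - y| := by
  obtain ⟨z, hz, h⟩ := exists_tan_sub_eq hr hx hy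
  have hr0 : 0 ≤ r := (abs_nonneg x).trans hx
  have hcosr : 0 < Real.cos r := Real.cos_pos_of_mem_Ioo ⟨by linarith, hr⟩
  have hcos : Real.cos r ≤ Real.cos z := by
    rw [← Real.cos_abs z]
    exact Real.cos_le_cos_of_nonneg_of_le_pi (abs_nonneg z) (by linarith [Real.pi_pos]) hz
  have hcosz : 0 < Real.cos z := hcosr.trans_le hcos
  rw [h, abs_mul, abs_of_pos (by positivity : 0 < 1 / Real.cos z ^ 2)]
  gcongr

/-- **Davenport's lemma.** For any finite set of directions `θ₁, ..., θ_k ⊂ [0, π/2]`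
there exists `α ∈ [0, π/2]` such that all the numbers `tan(α - θ_j)` are badly
approximable: for each `j` there is `c_j > 0` with `|tan(α - θ_j) - p/q| ≥ c_j/q²`
for all integers `p` and positive integers `q`. -/
theorem davenport_badly_approximable
    (k : ℕ) (θ : Fin k → ℝ) (hθ : ∀ j, θ j ∈ Set.Icc 0 (Real.pi / 2)) :
    ∃ α ∈ Set.Icc (0:ℝ) (Real.pi / 2), ∀ j : Fin k, ∃ c : ℝ, 0 < c ∧
      ∀ (p : ℤ) (q : ℕ), 0 < q →
        |Real.tan (α - θ j) - (p : ℝ) / (q : ℝ)| ≥ c / (q : ℝ) ^ 2 := by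
  rcases k with _ | k
  · exact ⟨0, ⟨le_rfl, by positivity⟩, fun j ↦ j.elim0⟩
  have hpi := Real.pi_pos
  have hr : 3 * Real.pi / 8 < Real.pi / 2 := by linarith
  have hmem (j : Fin (k + 1)) (x : ℝ) (hx : x ∈ Set.Icc (Real.pi / 8) (3 * Real.pi / 8)) :
      |x - θ j| ≤ 3 * Real.pi / 8 :=
    abs_le.2 ⟨by linarith [hx.1, (hθ j).2], by linarith [hx.2, (hθ j).1]⟩
  obtain ⟨α, hα, c, hc, h⟩ := exists_forall_badly_approximable (fun j x ↦ Real.tan (x - θ j))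
    (a := Real.pi / 8) (b := 3 * Real.pi / 8) (M := 1 / Real.cos (3 * Real.pi / 8) ^ 2)
    (by linarith) (by positivity)
    (fun j x hx y hy ↦ by simpa using abs_sub_le_abs_tan_sub hr (hmem j x hx) (hmem j y hy))
    (fun j x hx y hy ↦ by simpa using abs_tan_sub_le hr (hmem j x hx) (hmem j y hy))
  exact ⟨α, ⟨by linarith [hα.1], by linarith [hα.2]⟩, fun j ↦ ⟨c, hc, h j⟩⟩
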